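/- Let a, q ∈ ℂ with a ≠ 0 and q ≠ 0, let ℓ be an integer, and let k ≥ 0 be an integer such that (qa;q)_{k+1} ≠ 0, q^j a ≠ q^ℓ and q^j a ≠ q^{ℓ+1} for j ∈ {k, k+1}. Set L = q^ℓ and define f̃_k(a,q;ℓ) = s(a,q,L,q^k a)·f_k(a,q;ℓ,ℓ), where s(a,q,L,K) = [q(1+L)(1+qL)(1−qL²)(a−L)²(a−qL)² L² (1−K)^4 / (K(K−qL)²(K−L)²)] · [K(1+q³L⁶) + 4K(1+q)(1+q²L⁴)L − (4q² − K − 13qK − q²K + 4K²)(1+qL²)L² − 2(q³ + 7q(q+K²) + K²)L³]. Then −qL²(1+L)(1+4L+L²)(1−qL)³(1−La)²(1−qLa)²·f_k(a,q;ℓ+2,ℓ+2) + (1−qL²)·[1 + 5(1+q)L + (5+16q+5q²)L² + (1+q)(1−5q+q²)L³ − 2q(3+25q+3q²)L⁴ + q(1+q)(1−5q+q²)L⁵ + q²(5+16q+5q²)L⁶ + 5q³(1+q)L⁷ + q⁴L⁸]·(1−La)²(a−qL)²·f_k(a,q;ℓ+1,ℓ+1) − qL²(1−L)³(1+qL)(1+4qL+q²L²)(a−L)²(a−qL)²·f_k(a,q;ℓ,ℓ)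 = f̃_{k+1}(a,q;ℓ) − f̃_k(a,q;ℓ). -/

import Mathlib

open Finset

/-- The q-Pochhammer symbol `(x;q)_k = ∏_{j=0}^{k-1} (1 - x q^j)`. -/
noncomputable def qPoch (x q : ℂ) (k : ℕ) : ℂ := ∏ j ∈ Finset.range k, (1 - x * q ^ j)

/-- The summand `f_k(a,q;ℓ1,ℓ2)`. -/
noncomputable def f (a q : ℂ) (l1 l2 : ℤ) (k : ℕ) : ℂ :=
  qPoch (q ^ l1 * a) q k * qPoch (q ^ (1 - l1) * a) q k *
    qPoch (q ^ l2 * a) q k * qPoch (q ^ (1 - l2) * a) q k * q ^ k /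
    (qPoch (q * a) q k) ^ 4

/-- The certificate `s(a,q,L,K)` from the creative telescoping relation. -/
noncomputable def s (a q L K : ℂ) : ℂ :=
  q * (1 + L) * (1 + q * L) * (1 - q * L ^ 2) * (a - L) ^ 2 * (a - q * L) ^ 2 *
      L ^ 2 * (1 - K) ^ 4 / (K * (K - q * L) ^ 2 * (K - L) ^ 2) *
    (K * (1 + q ^ 3 * L ^ 6) + 4 * K * (1 + q) * (1 + q ^ 2 * L ^ 4) * L -
      (4 * q ^ 2 - K - 13 * q * K - q ^ 2 * K + 4 * K ^ 2) * (1 + q * L ^ 2) * L ^ 2 -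
      2 * (q ^ 3 + 7 * q * (q + K ^ 2) + K ^ 2) * L ^ 3)

/-- The telescoped term `f̃_k(a,q;ℓ) = s(a,q,q^ℓ,q^k a) f_k(a,q;ℓ,ℓ)`. -/
noncomputable def ftilde (a q : ℂ) (l : ℤ) (k : ℕ) : ℂ :=
  s a q (q ^ l) (q ^ k * a) * f a q l l k

theorem qPoch_succ (x q : ℂ) (k : ℕ) :
    qPoch x q (k + 1) = qPoch x q k * (1 - x * q ^ k) := by
  simp [qPoch, Finset.prod_range_succ]

theorem one_sub_mul_qPoch (x q : ℂ) (k : ℕ) :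
    (1 - x) * qPoch (q * x) q k = qPoch x q k * (1 - x * q ^ k) := by
  rw [← qPoch_succ, qPoch, qPoch, Finset.prod_range_succ', mul_comm]
  congr 1
  · exact Finset.prod_congr rfl fun j _ => by ring
  · simp

theorem f_diag (a q : ℂ) (l : ℤ) (k : ℕ) :
    f a q l l k = (qPoch (q ^ l * a) q k) ^ 2 * (qPoch (q ^ (1 - l) * a) q k) ^ 2 *
      (q ^ k / (qPoch (q * a) q k) ^ 4) := by
  rw [f]
  ring

/-- Raising the first parameter, in a form without division by `1 - q ^ l * a`. -/
theorem qPoch_zpow_add_one {q : ℂ} (hq : q ≠ 0) (a : ℂ) (l : ℤ) (k : ℕ) :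
    (1 - q ^ l * a) * qPoch (q ^ (l + 1) * a) q k =
      qPoch (q ^ l * a) q k * (1 - q ^ l * (q ^ k * a)) := by
  have h := one_sub_mul_qPoch (q ^ l * a) q k
  rw [← mul_assoc, ← zpow_one_add₀ hq, add_comm 1 l] at h
  rw [h]
  ring

/-- Lowering the reflected parameter. -/
theorem qPoch_zpow_one_sub_add_one {q : ℂ} (hq : q ≠ 0) (a : ℂ) (l : ℤ) (k : ℕ)
    (h : q ^ k * a ≠ q ^ l) :
    qPoch (q ^ (1 - (l + 1)) * a) q k =
      (a - q ^ l) / (q ^ k * a - q ^ l) * qPoch (q ^ (1 - l) * a) q k := by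
  have hL : q ^ l ≠ 0 := zpow_ne_zero _ hq
  have hsub : q ^ k * a - q ^ l ≠ 0 := sub_ne_zero.mpr h
  have hstep := one_sub_mul_qPoch (q ^ (-l) * a) q k
  rw [← mul_assoc, ← zpow_one_add₀ hq, ← sub_eq_add_neg, zpow_neg] at hstep
  rw [show 1 - (l + 1) = -l by ring, zpow_neg,
    div_mul_eq_mul_div, eq_div_iff hsub]
  field_simp at hstep ⊢
  linear_combination hstep

/-- The shift in `k` of the diagonal summand. -/
theorem f_diag_succ {q : ℂ} (hq : q ≠ 0) (a : ℂ) (l : ℤ) (k : ℕ) :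
    f a q l l (k + 1) = q * (1 - q ^ l * (q ^ k * a)) ^ 2 * (q ^ l - q * (q ^ k * a)) ^ 2 /
      ((q ^ l) ^ 2 * (1 - q * (q ^ k * a)) ^ 4) * f a q l l k := by
  have hL : q ^ l ≠ 0 := zpow_ne_zero _ hq
  have hB : q ^ (1 - l) = q / q ^ l := by rw [zpow_sub₀ hq, zpow_one]
  have e : 1 - q / q ^ l * a * q ^ k = (q ^ l - q * (q ^ k * a)) / q ^ l := by
    field_simp
  rw [f_diag, f_diag, qPoch_succ, qPoch_succ, qPoch_succ, hB, e,
    show 1 - q * a * q ^ k = 1 - q * (q ^ k * a) by ring,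
    show 1 - q ^ l * a * q ^ k = 1 - q ^ l * (q ^ k * a) by ring]
  simp only [div_eq_mul_inv, mul_pow, mul_inv, inv_pow, pow_succ q k]
  ring

/-- The rational function identity behind the telescoping relation. -/
theorem telescoping_certificate (a q L K : ℂ) (hq : q ≠ 0) (hL : L ≠ 0) (hK : K ≠ 0)
    (h0 : 1 - q * K ≠ 0) (h1 : K - L ≠ 0) (h2 : K - q * L ≠ 0) (h3 : q * K - L ≠ 0) :
    -(q * L ^ 2 * (1 + L) * (1 + 4 * L + L ^ 2) * (1 - q * L) ^ 3 *
          (1 - L * K) ^ 2 * (1 - q * L * K) ^ 2) *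
          ((a - q * L) / (K - q * L) * ((a - L) / (K - L))) ^ 2 +
      (1 - q * L ^ 2) *
        (1 + 5 * (1 + q) * L + (5 + 16 * q + 5 * q ^ 2) * L ^ 2 +
          (1 + q) * (1 - 5 * q + q ^ 2) * L ^ 3 -
          2 * q * (3 + 25 * q + 3 * q ^ 2) * L ^ 4 +
          q * (1 + q) * (1 - 5 * q + q ^ 2) * L ^ 5 +
          q ^ 2 * (5 + 16 * q + 5 * q ^ 2) * L ^ 6 +
          5 * q ^ 3 * (1 + q) * L ^ 7 + q ^ 4 * L ^ 8) *
        (1 - L * K) ^ 2 * (a - q * L) ^ 2 * ((a - L) / (K - L)) ^ 2 -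
      q * L ^ 2 * (1 - L) ^ 3 * (1 + q * L) * (1 + 4 * q * L + q ^ 2 * L ^ 2) *
        (a - L) ^ 2 * (a - q * L) ^ 2 =
      s a q L (q * K) * (q * (1 - L * K) ^ 2 * (L - q * K) ^ 2 /
        (L ^ 2 * (1 - q * K) ^ 4)) - s a q L K := by
  have e : s a q L (q * K) * (q * (1 - L * K) ^ 2 * (L - q * K) ^ 2 /
        (L ^ 2 * (1 - q * K) ^ 4)) =
      (1 + L) * (1 + q * L) * (1 - q * L ^ 2) * (a - L) ^ 2 * (a - q * L) ^ 2 *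
        (1 - L * K) ^ 2 / (K * (K - L) ^ 2) *
        (K * (1 + q ^ 3 * L ^ 6) + 4 * K * (1 + q) * (1 + q ^ 2 * L ^ 4) * L -
          (4 * q - K - 13 * q * K - q ^ 2 * K + 4 * q * K ^ 2) * (1 + q * L ^ 2) * L ^ 2 -
          2 * (q ^ 2 + 7 * q * (1 + q * K ^ 2) + q * K ^ 2) * L ^ 3) := by
    rw [s, ← mul_sub, ← neg_sub (q * K) L]
    field_simp
  rw [e, s]
  field_simp
  ring

theorem stmt_12 (a q : ℂ) (ha : a ≠ 0) (hq : q ≠ 0) (l : ℤ) (k : ℕ)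
    (hk : qPoch (q * a) q (k + 1) ≠ 0)
    (h1 : ∀ j : ℕ, j = k ∨ j = k + 1 → q ^ j * a ≠ q ^ l)
    (h2 : ∀ j : ℕ, j = k ∨ j = k + 1 → q ^ j * a ≠ q ^ (l + 1))
    (L : ℂ) (hL : L = q ^ l) :
    -(q * L ^ 2 * (1 + L) * (1 + 4 * L + L ^ 2) * (1 - q * L) ^ 3 *
          (1 - L * a) ^ 2 * (1 - q * L * a) ^ 2) * f a q (l + 2) (l + 2) k +
      (1 - q * L ^ 2) *
        (1 + 5 * (1 + q) * L + (5 + 16 * q + 5 * q ^ 2) * L ^ 2 +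
          (1 + q) * (1 - 5 * q + q ^ 2) * L ^ 3 -
          2 * q * (3 + 25 * q + 3 * q ^ 2) * L ^ 4 +
          q * (1 + q) * (1 - 5 * q + q ^ 2) * L ^ 5 +
          q ^ 2 * (5 + 16 * q + 5 * q ^ 2) * L ^ 6 +
          5 * q ^ 3 * (1 + q) * L ^ 7 + q ^ 4 * L ^ 8) *
        (1 - L * a) ^ 2 * (a - q * L) ^ 2 * f a q (l + 1) (l + 1) k -
      q * L ^ 2 * (1 - L) ^ 3 * (1 + q * L) * (1 + 4 * q * L + q ^ 2 * L ^ 2) *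
        (a - L) ^ 2 * (a - q * L) ^ 2 * f a q l l k =
      ftilde a q l (k + 1) - ftilde a q l k := by
  have hL0 : q ^ l ≠ 0 := zpow_ne_zero _ hq
  have hL1 : q ^ (l + 1) = q * q ^ l := by rw [zpow_add_one₀ hq, mul_comm]
  have hk0 : q ^ k * a ≠ q ^ l := h1 k (Or.inl rfl)
  have hk1 : q ^ k * a ≠ q ^ (l + 1) := h2 k (Or.inl rfl)
  have hk2 : q ^ (k + 1) * a ≠ q ^ l := h1 (k + 1) (Or.inr rfl)
  have hK1 : q ^ (k + 1) * a = q * (q ^ k * a) := by ring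
  have hC : 1 - q * (q ^ k * a) ≠ 0 := by
    rw [qPoch_succ] at hk
    convert right_ne_zero_of_mul hk using 1
    ring
  have hA1 := qPoch_zpow_add_one hq a l k
  have hA2 := qPoch_zpow_add_one hq a (l + 1) k
  have hB1 := qPoch_zpow_one_sub_add_one hq a l k hk0
  have hB2 := qPoch_zpow_one_sub_add_one hq a (l + 1) k hk1
  rw [hB1] at hB2
  have hcert := telescoping_certificate a q (q ^ l) (q ^ k * a) hq hL0
    (mul_ne_zero (pow_ne_zero _ hq) ha) hC (sub_ne_zero.mpr hk0)
    (sub_ne_zero.mpr (hL1 ▸ hk1)) (sub_ne_zero.mpr (hK1 ▸ hk2))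
  have hf1 : (1 - q ^ l * a) ^ 2 * f a q (l + 1) (l + 1) k =
      (1 - q ^ l * (q ^ k * a)) ^ 2 * ((a - q ^ l) / (q ^ k * a - q ^ l)) ^ 2 *
        f a q l l k := by
    rw [f_diag, f_diag, hB1, ← mul_assoc, ← mul_assoc, ← mul_pow, hA1]
    ring
  have hf2 : (1 - q ^ l * a) ^ 2 * (1 - q * q ^ l * a) ^ 2 * f a q (l + 2) (l + 2) k =
      (1 - q ^ l * (q ^ k * a)) ^ 2 * (1 - q * q ^ l * (q ^ k * a)) ^ 2 *
        ((a - q * q ^ l) / (q ^ k * a - q * q ^ l) *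
          ((a - q ^ l) / (q ^ k * a - q ^ l))) ^ 2 * f a q l l k := by
    have hA : (1 - q ^ l * a) * (1 - q * q ^ l * a) * qPoch (q ^ (l + 1 + 1) * a) q k =
        qPoch (q ^ l * a) q k * (1 - q ^ l * (q ^ k * a)) *
          (1 - q * q ^ l * (q ^ k * a)) := by
      rw [hL1] at hA1 hA2
      linear_combination (1 - q ^ l * a) * hA2 + (1 - q * q ^ l * (q ^ k * a)) * hA1
    rw [show l + 2 = l + 1 + 1 by ring, f_diag, f_diag, hB2, hL1, ← mul_assoc, ← mul_assoc,
      ← mul_pow, ← mul_pow, hA]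
    ring
  rw [ftilde, ftilde, f_diag_succ hq, hK1, hL]
  linear_combination
    -(q * (q ^ l) ^ 2 * (1 + q ^ l) * (1 + 4 * q ^ l + (q ^ l) ^ 2) * (1 - q * q ^ l) ^ 3) *
        hf2 +
      (1 - q * (q ^ l) ^ 2) *
        (1 + 5 * (1 + q) * q ^ l + (5 + 16 * q + 5 * q ^ 2) * (q ^ l) ^ 2 +
          (1 + q) * (1 - 5 * q + q ^ 2) * (q ^ l) ^ 3 -
          2 * q * (3 + 25 * q + 3 * q ^ 2) * (q ^ l) ^ 4 +
          q * (1 + q) * (1 - 5 * q + q ^ 2) * (q ^ l) ^ 5 +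
          q ^ 2 * (5 + 16 * q + 5 * q ^ 2) * (q ^ l) ^ 6 +
          5 * q ^ 3 * (1 + q) * (q ^ l) ^ 7 + q ^ 4 * (q ^ l) ^ 8) *
        (a - q * q ^ l) ^ 2 * hf1 +
      f a q l l k * hcert
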